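/- Let L be a restricted Lie algebra over a field F of characteristic p > 0 and let N be a restricted subalgebra of L. Then L ∩ ([N,L] + Nω(L)) = [N,L] + N^p, where the intersection is taken inside u(L). -/

import Mathlib

open UniversalEnvelopingAlgebra

attribute [local instance 100] LieRing.ofAssociativeRing

/-- A restricted Lie algebra over a field `F` of characteristic `p`: a Lie algebra equipped
with a `p`-map `x ↦ x^[p]` satisfying Jacobson's identities.  The additive identity
`(x+y)^[p] = x^[p] + y^[p] + Σ sᵢ(x,y)` (with `sᵢ` the Jacobson polynomials) is expressed
faithfully inside the universal enveloping algebra, where it reads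
`ι((x+y)^[p]) - ι(x^[p]) - ι(y^[p]) = (ι x + ι y)^p - (ι x)^p - (ι y)^p`. -/
class RestrictedLieAlgebra (p : ℕ) (F : Type*) (L : Type*) [Field F]
    [LieRing L] [LieAlgebra F L] : Type _ where
  pOp : L → L
  pOp_smul : ∀ (a : F) (x : L), pOp (a • x) = a ^ p • pOp x
  ad_pOp : ∀ x y : L, ⁅pOp x, y⁆ = ((LieAlgebra.ad F L x) ^ p) y
  pOp_add : ∀ x y : L,
    ι F (pOp (x + y)) - ι F (pOp x) - ι F (pOp y)
      = (ι F x + ι F y) ^ p - (ι F x) ^ p - (ι F y) ^ p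

namespace RestrictedLieAlgebra

variable (p : ℕ) (F : Type*) [Field F]

section Defs

variable (L : Type*) [LieRing L] [LieAlgebra F L] [RestrictedLieAlgebra p F L]

/-- The `p`-map of a restricted Lie algebra. -/
abbrev pmap (x : L) : L := RestrictedLieAlgebra.pOp (p := p) (F := F) x

/-- The relation defining the restricted enveloping algebra as a quotient of the
universal enveloping algebra: `x^p = x^[p]` for all `x ∈ L`. -/
def uRel : UniversalEnvelopingAlgebra F L → UniversalEnvelopingAlgebra F L → Prop :=
  fun a b => ∃ x : L, a = (ι F x) ^ p ∧ b = ι F (pmap p F L x)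

/-- The restricted enveloping algebra `u(L)`: the quotient of the universal enveloping
algebra of `L` by the two-sided ideal generated by `{x^p - x^[p] : x ∈ L}`. -/
abbrev uEnv := RingQuot (uRel p F L)

/-- The canonical (linear) embedding `L → u(L)`. -/
def uemb : L →ₗ[F] uEnv p F L :=
  ((RingQuot.mkAlgHom F (uRel p F L)).toLinearMap).comp (ι F : L →ₗ⁅F⁆ _).toLinearMap

variable [Fact p.Prime]

/-- The augmentation map `ε : u(L) → F`, induced by `x ↦ 0` for `x ∈ L`. -/
noncomputable def aug : uEnv p F L →ₐ[F] F :=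
  RingQuot.liftAlgHom F
    ⟨(UniversalEnvelopingAlgebra.lift F) (0 : L →ₗ⁅F⁆ F), by
      rintro a b ⟨x, rfl, rfl⟩
      simp [UniversalEnvelopingAlgebra.lift_ι_apply,
        zero_pow (Nat.Prime.ne_zero (Fact.out : p.Prime))]⟩

/-- The augmentation ideal `ω(L)`, i.e. the kernel of the augmentation map, as a
subspace of `u(L)`. -/
noncomputable def omegaIdeal : Submodule F (uEnv p F L) :=
  LinearMap.ker (aug p F L).toLinearMap

/-- The image of `L` inside `u(L)`. -/
def lSub : Submodule F (uEnv p F L) := LinearMap.range (uemb p F L)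

end Defs

section Closure

variable {L : Type*} [LieRing L] [LieAlgebra F L] [RestrictedLieAlgebra p F L]

/-- The restricted subalgebra generated by a subset `S` of `L`: the smallest Lie
subalgebra containing `S` which is closed under the `p`-map. -/
def restrictedClosure (S : Set L) : LieSubalgebra F L :=
  sInf {K : LieSubalgebra F L | S ⊆ K ∧ ∀ x ∈ K, pmap p F L x ∈ K}

/-- For a subalgebra `N ⊆ L`, the restricted subalgebra `N^p` generated by all
`x^[p]`, `x ∈ N`. -/
def subPPow (K : LieSubalgebra F L) : LieSubalgebra F L :=
  restrictedClosure p F (pmap p F L '' K)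

end Closure

section PNilpotent

variable (L : Type*) [LieRing L] [LieAlgebra F L] [RestrictedLieAlgebra p F L]

/-- `L` is `p`-nilpotent if `L^{pˢ} = 0` for some `s`, where `L^p` denotes the restricted
subalgebra generated by all `x^[p]`. -/
def IsPNilpotent : Prop :=
  ∃ s : ℕ, (subPPow p F)^[s] (⊤ : LieSubalgebra F L) = ⊥

/-- The derived subalgebra `L' = γ₂(L)` as a submodule of `L`. -/
abbrev derivedSub : Submodule F L := (LieModule.lowerCentralSeries F L L 1).toSubmodule

/-- `L'_p`, the restricted subalgebra generated by `L'`, as a submodule. -/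
def derivedP : Submodule F L :=
  (restrictedClosure p F (derivedSub F L : Set L)).toSubmodule

/-- `L'^p + γ₃(L)`, as a submodule of `L`. -/
def mainIdeal : Submodule F L :=
  (subPPow p F (restrictedClosure p F (derivedSub F L : Set L))).toSubmodule
    ⊔ (LieModule.lowerCentralSeries F L L 2).toSubmodule

end PNilpotent

end RestrictedLieAlgebra

namespace RestrictedLieAlgebra

open Module Submodule

/-- Newman's lemma for linear rewriting systems: if a terminating system of linear rewriting
rules on basis vectors is locally confluent, then every assignment of values to the irreducible
basis vectors extends to a linear map compatible with all the rules. -/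
theorem exists_linearMap_of_confluent {F W T A : Type*} [Field F] [AddCommGroup T] [Module F T]
    [AddCommGroup A] [Module F A] (B : Basis W F T) {r : W → W → Prop} (hr : WellFounded r)
    (Rel : W → T → Prop)
    (hdesc : ∀ w f, Rel w f → f ∈ span F (B '' {v | r v w}))
    (hconf : ∀ w f g, Rel w f → Rel w g →
      f - g ∈ span F {t | ∃ v h, r v w ∧ Rel v h ∧ t = B v - h})
    (ψ : W → A) :
    ∃ φ : T →ₗ[F] A, (∀ w, (∀ f, ¬ Rel w f) → φ (B w) = ψ w) ∧
      ∀ w f, Rel w f → φ (B w) = φ f := by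
  classical
  let value : W → A := hr.fix fun w rec =>
    if h : ∃ f, Rel w f then
      (B.repr h.choose).sum fun v c => c • if hv : r v w then rec v hv else 0
    else ψ w
  have value_eq (w : W) : value w = if h : ∃ f, Rel w f then
      (B.repr h.choose).sum fun v c => c • if r v w then value v else 0
    else ψ w := by
    change hr.fix _ w = _
    rw [hr.fix_eq]
    rfl
  let φ : T →ₗ[F] A := B.constr F value
  have φ_apply (w : W) : φ (B w) = value w := B.constr_basis F value w
  refine ⟨φ, fun w hw => ?_, ?_⟩
  · rw [φ_apply, value_eq, dif_neg (by simpa using hw)]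
  intro w
  induction w using hr.induction with
  | _ w ih =>
    intro f hf
    have hex : ∃ f, Rel w f := ⟨f, hf⟩
    have hchosen : φ (B w) = φ hex.choose := by
      rw [φ_apply, value_eq, dif_pos hex, Basis.constr_apply]
      refine Finsupp.sum_congr fun v hv => ?_
      have hvw : r v w := B.mem_span_image.mp (hdesc w _ hex.choose_spec) hv
      rw [if_pos hvw]
    rw [hchosen, ← sub_eq_zero, ← map_sub, ← LinearMap.mem_ker]
    refine span_le.mpr ?_ (hconf w _ _ hex.choose_spec hf)
    rintro _ ⟨v, h, hv, hvh, rfl⟩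
    rw [SetLike.mem_coe, LinearMap.mem_ker, map_sub, sub_eq_zero]
    exact ih v hv h hvh

theorem choose_prime_sub_one (p : ℕ) [hp : Fact p.Prime] (R : Type*) [Ring R] [CharP R p]
    {s : ℕ} (hs : s < p) : ((p - 1).choose s : R) = (-1) ^ s := by
  induction s with
  | zero => simp
  | succ s ih =>
    have h : p.choose (s + 1) = (p - 1).choose s + (p - 1).choose (s + 1) := by
      rw [← Nat.choose_succ_succ, Nat.succ_eq_add_one, Nat.sub_add_cancel hp.out.one_le]
    have h0 : (p.choose (s + 1) : R) = 0 :=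
      (CharP.cast_eq_zero_iff R p _).mpr (hp.out.dvd_choose_self s.succ_ne_zero hs)
    rw [h, Nat.cast_add, ih (by omega)] at h0
    rw [pow_succ, mul_neg_one, eq_neg_iff_add_eq_zero, add_comm, h0]

theorem _root_.Commute.sub_pow_prime_sub_one (p : ℕ) [hp : Fact p.Prime] {R : Type*} [Ring R]
    [CharP R p] {x y : R} (h : Commute x y) :
    (x - y) ^ (p - 1) = ∑ s ∈ Finset.range p, x ^ s * y ^ (p - 1 - s) := by
  rw [sub_eq_neg_add, (h.neg_right).symm.add_pow, Nat.sub_add_cancel hp.out.one_le]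
  rw [← Finset.sum_range_reflect]
  refine Finset.sum_congr rfl fun s hs => ?_
  have hs : s < p := Finset.mem_range.mp hs
  have hsign : ((-1 : R)) ^ (p - 1 - s) * (-1) ^ (p - 1 - s) = 1 := by
    rw [← pow_add, Even.neg_one_pow ⟨_, rfl⟩]
  have hcomm : Commute ((-1 : R) ^ (p - 1 - s)) (y ^ (p - 1 - s) * x ^ s) :=
    (Commute.neg_one_left _).pow_left _
  rw [show p - 1 - (p - 1 - s) = s by omega, choose_prime_sub_one p R (by omega), neg_pow y,
    mul_assoc, mul_assoc, ← mul_assoc (y ^ _), ← hcomm.eq, ← mul_assoc, hsign, one_mul,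
    (h.pow_pow _ _).eq]

end RestrictedLieAlgebra

theorem List.Lex.append_of_length_eq {α : Type*} {r : α → α → Prop} {s t : List α}
    (h : List.Lex r s t) (hl : s.length = t.length) (u : List α) :
    List.Lex r (s ++ u) (t ++ u) := by
  induction h with
  | nil => simp at hl
  | cons _ ih => exact .cons (ih (by simpa using hl))
  | rel h => exact .rel h

theorem List.Shortlex.append_append {α : Type*} {r : α → α → Prop} {s t : List α}
    (h : List.Shortlex r s t) (u v : List α) :
    List.Shortlex r (u ++ (s ++ v)) (u ++ (t ++ v)) := by
  refine List.Shortlex.append_left ?_ u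
  rcases List.shortlex_def.mp h with h | ⟨hl, h⟩
  · exact .of_length_lt (by simpa using h)
  · exact .of_lex (by simpa using hl) (h.append_of_length_eq hl v)

namespace RestrictedLieAlgebra

open Module Submodule

section FreeAlgebra

variable (F : Type*) [Field F] {X : Type*}

/-- The noncommutative monomial attached to a list of letters. -/
noncomputable def word (l : List X) : FreeAlgebra F X := (l.map (FreeAlgebra.ι F)).prod

@[simp] theorem word_nil : word F ([] : List X) = 1 := rfl

@[simp] theorem word_cons (i : X) (l : List X) :
    word F (i :: l) = FreeAlgebra.ι F i * word F l := by simp [word]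

@[simp] theorem word_append (l m : List X) : word F (l ++ m) = word F l * word F m := by
  simp [word]

@[simp] theorem word_replicate (n : ℕ) (i : X) :
    word F (List.replicate n i) = FreeAlgebra.ι F i ^ n := by simp [word]

variable (X) in
/-- The monomials form a basis of the free algebra. -/
noncomputable def wordBasis : Basis (List X) F (FreeAlgebra F X) :=
  (FreeAlgebra.basisFreeMonoid F X).reindex FreeMonoid.toList

@[simp] theorem wordBasis_apply (l : List X) : wordBasis F X l = word F l := by
  rw [wordBasis, Basis.reindex_apply, FreeAlgebra.basisFreeMonoid, Basis.map_apply,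
    Finsupp.coe_basisSingleOne]
  change FreeAlgebra.equivMonoidAlgebraFreeMonoid.symm
    (MonoidAlgebra.single (FreeMonoid.ofList l) (1 : F)) = _
  rw [← MonoidAlgebra.of_apply]
  simp [FreeAlgebra.equivMonoidAlgebraFreeMonoid, word, FreeMonoid.lift_apply]

theorem mul_pow_sub_pow_mul {R : Type*} [Ring R] (x y : R) (n : ℕ) :
    x * y ^ n - y ^ n * x
      = ∑ s ∈ Finset.range n, y ^ s * (x * y - y * x) * y ^ (n - 1 - s) := by
  induction n with
  | zero => simp
  | succ n ih =>
    have hsum : ∑ s ∈ Finset.range n, y ^ s * (x * y - y * x) * y ^ (n - s)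
        = (x * y ^ n - y ^ n * x) * y := by
      rw [ih, Finset.sum_mul]
      refine Finset.sum_congr rfl fun s hs => ?_
      have hs : s < n := Finset.mem_range.mp hs
      rw [show n - s = n - 1 - s + 1 by omega, pow_succ, mul_assoc]
      simp only [mul_assoc]
    rw [Finset.sum_range_succ]
    simp only [Nat.add_sub_cancel, hsum, Nat.sub_self, pow_zero, mul_one, pow_succ]
    noncomm_ring

end FreeAlgebra

section Rewriting

variable (p : ℕ) {F L X : Type*} [Field F] [LieRing L] [LieAlgebra F L]
  [RestrictedLieAlgebra p F L] (b : Basis X F L)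

/-- The linear embedding of `L` in the free algebra on a basis of `L`. -/
noncomputable def lin : L →ₗ[F] FreeAlgebra F X := b.constr F (FreeAlgebra.ι F)

@[simp] theorem lin_basis (i : X) : lin b (b i) = FreeAlgebra.ι F i := b.constr_basis F _ i

/-- The commutation relation between two letters. -/
noncomputable def commRel (i j : X) : FreeAlgebra F X :=
  FreeAlgebra.ι F i * FreeAlgebra.ι F j - FreeAlgebra.ι F j * FreeAlgebra.ι F i
    - lin b ⁅b i, b j⁆

/-- The `p`-th power relation of a letter. -/
noncomputable def powRel (i : X) : FreeAlgebra F X :=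
  FreeAlgebra.ι F i ^ p - lin b (pmap p F L (b i))

theorem neg_commRel (i j : X) : -commRel b i j = commRel b j i := by
  rw [commRel, commRel, ← lie_skew (b i), map_neg]
  noncomm_ring

variable [LinearOrder X]

/-- The defining relations of `u(L)` in terms of a basis of `L`, oriented as rewriting rules:
out-of-order pairs of letters are swapped, and `p`-th powers of letters are replaced. -/
inductive BasicRule : List X → FreeAlgebra F X → Prop
  | swap {i j : X} (h : j < i) : BasicRule [i, j]
      (FreeAlgebra.ι F j * FreeAlgebra.ι F i + lin b ⁅b i, b j⁆)
  | pow (i : X) : BasicRule (List.replicate p i) (lin b (pmap p F L (b i)))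

/-- Application of a basic rule to a subword. -/
def Rule (w : List X) (g : FreeAlgebra F X) : Prop :=
  ∃ u w' v f, BasicRule p b w' f ∧ w = u ++ (w' ++ v) ∧ g = word F u * f * word F v

/-- The span of the rewriting relations whose leading word is smaller than `w`. -/
def lowerRel (w : List X) : Submodule F (FreeAlgebra F X) :=
  span F {t | ∃ v h, List.Shortlex (· < ·) v w ∧ Rule p b v h ∧ t = wordBasis F X v - h}

variable {p b}

theorem mul_sub_mul_mem_lowerRel {u v w W : List X} {f : FreeAlgebra F X}
    (hf : BasicRule p b w f) (h : List.Shortlex (· < ·) (u ++ (w ++ v)) W) :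
    word F u * (word F w - f) * word F v ∈ lowerRel p b W := by
  refine subset_span ⟨_, _, h, ⟨u, w, v, f, hf, rfl, rfl⟩, ?_⟩
  simp only [wordBasis_apply, word_append]
  noncomm_ring

theorem word_mul_mul_word_mem_span {u v w : List X} {f : FreeAlgebra F X}
    (hf : f ∈ span F (wordBasis F X '' {w' | List.Shortlex (· < ·) w' w})) :
    word F u * f * word F v ∈
      span F (wordBasis F X '' {w' | List.Shortlex (· < ·) w' (u ++ (w ++ v))}) := by
  induction hf using span_induction with
  | mem x hx =>
    obtain ⟨w', hw', rfl⟩ := hx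
    refine subset_span ⟨u ++ (w' ++ v), List.Shortlex.append_append hw' u v, ?_⟩
    simp [mul_assoc]
  | zero => simp
  | add x y _ _ hx hy => rw [mul_add, add_mul]; exact add_mem hx hy
  | smul c x _ hx => rw [mul_smul_comm, smul_mul_assoc]; exact smul_mem _ c hx

theorem lin_mem_span (x : L) {w : List X} (hw : 1 < w.length) :
    lin b x ∈ span F (wordBasis F X '' {w' | List.Shortlex (· < ·) w' w}) := by
  induction b.mem_span x using span_induction with
  | mem x hx =>
    obtain ⟨i, rfl⟩ := hx
    exact subset_span ⟨[i], .of_length_lt (by simpa using hw), by simp⟩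
  | zero => simp
  | add x y _ _ hx hy => rw [map_add]; exact add_mem hx hy
  | smul c x _ hx => rw [map_smul]; exact smul_mem _ c hx

theorem BasicRule.mem_span [hp : Fact p.Prime] {w : List X} {f : FreeAlgebra F X}
    (hf : BasicRule p b w f) :
    f ∈ span F (wordBasis F X '' {w' | List.Shortlex (· < ·) w' w}) := by
  cases hf with
  | @swap i j h =>
    refine add_mem (subset_span ⟨[j, i], .of_lex rfl (.rel h), ?_⟩) (lin_mem_span _ (by simp))
    simp
  | pow i => exact lin_mem_span _ (by simpa using hp.out.one_lt)

theorem Rule.mem_span [Fact p.Prime] {w : List X} {g : FreeAlgebra F X} (hg : Rule p b w g) :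
    g ∈ span F (wordBasis F X '' {w' | List.Shortlex (· < ·) w' w}) := by
  obtain ⟨u, w', v, f, hf, rfl, rfl⟩ := hg
  exact word_mul_mul_word_mem_span hf.mem_span

/-- A rewriting relation multiplied by an element below the word `w`. -/
theorem mul_mul_mem_lowerRel_left {u c v w w' : List X} {f g : FreeAlgebra F X}
    (hf : BasicRule p b w f)
    (hg : g ∈ span F (wordBasis F X '' {x | List.Shortlex (· < ·) x w'})) :
    word F u * (word F w - f) * word F c * g * word F v
      ∈ lowerRel p b (u ++ (w ++ (c ++ (w' ++ v)))) := by
  induction hg using span_induction with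
  | mem x hx =>
    obtain ⟨x, hx, rfl⟩ := hx
    have := mul_sub_mul_mem_lowerRel (u := u) (v := c ++ (x ++ v)) hf
      (W := u ++ (w ++ (c ++ (w' ++ v))))
      (by simpa using List.Shortlex.append_append hx (u ++ (w ++ c)) v)
    simpa [mul_assoc] using this
  | zero => simp
  | add x y _ _ hx hy => rw [mul_add, add_mul]; exact add_mem hx hy
  | smul c x _ hx => rw [mul_smul_comm, smul_mul_assoc]; exact smul_mem _ c hx

theorem mul_mul_mem_lowerRel_right {u c v w w' : List X} {f g : FreeAlgebra F X}
    (hf : BasicRule p b w' f)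
    (hg : g ∈ span F (wordBasis F X '' {x | List.Shortlex (· < ·) x w})) :
    word F u * g * word F c * (word F w' - f) * word F v
      ∈ lowerRel p b (u ++ (w ++ (c ++ (w' ++ v)))) := by
  induction hg using span_induction with
  | mem x hx =>
    obtain ⟨x, hx, rfl⟩ := hx
    have := mul_sub_mul_mem_lowerRel (u := u ++ (x ++ c)) (v := v) hf
      (W := u ++ (w ++ (c ++ (w' ++ v))))
      (by simpa using List.Shortlex.append_append hx u (c ++ (w' ++ v)))
    simpa [mul_assoc] using this
  | zero => simp
  | add x y _ _ hx hy => simp only [mul_add, add_mul]; exact add_mem hx hy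
  | smul c x _ hx => simp only [mul_smul_comm, smul_mul_assoc]; exact smul_mem _ c hx

theorem mul_commRel_mul_mem_lowerRel {u v W : List X} {i j : X}
    (h : List.Shortlex (· < ·) (u ++ (i :: j :: v)) W)
    (h' : List.Shortlex (· < ·) (u ++ (j :: i :: v)) W) :
    word F u * commRel b i j * word F v ∈ lowerRel p b W := by
  rcases lt_trichotomy j i with hij | rfl | hij
  · have := mul_sub_mul_mem_lowerRel (BasicRule.swap (p := p) (b := b) hij) (u := u) (v := v) h
    convert this using 3
    simp only [commRel, word_cons, word_nil]
    noncomm_ring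
  · simp [commRel]
  · have := mul_sub_mul_mem_lowerRel (BasicRule.swap (p := p) (b := b) hij) (u := u) (v := v) h'
    rw [← neg_commRel b, mul_neg, neg_mul]
    refine neg_mem ?_
    convert this using 3
    simp only [commRel, word_cons, word_nil]
    noncomm_ring

theorem mul_powRel_mul_mem_lowerRel {u v W : List X} {i : X}
    (h : List.Shortlex (· < ·) (u ++ (List.replicate p i ++ v)) W) :
    word F u * powRel p b i * word F v ∈ lowerRel p b W := by
  simpa [powRel] using mul_sub_mul_mem_lowerRel (BasicRule.pow (p := p) (b := b) i) h

variable (p b) in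
/-- The elements which, multiplied on both sides by words of total length less than
`W.length - n`, lie in `lowerRel p b W`. -/
def lowerRelOfDegree (W : List X) (n : ℕ) : Submodule F (FreeAlgebra F X) where
  carrier := {t | ∀ u v : List X, u.length + v.length + n < W.length →
    word F u * t * word F v ∈ lowerRel p b W}
  zero_mem' u v _ := by simp
  add_mem' hx hy u v h := by rw [mul_add, add_mul]; exact add_mem (hx u v h) (hy u v h)
  smul_mem' c x hx u v h := by
    rw [mul_smul_comm, smul_mul_assoc]; exact smul_mem _ c (hx u v h)

theorem lowerRelOfDegree_mono {W : List X} {m n : ℕ} (h : m ≤ n) :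
    lowerRelOfDegree p b W m ≤ lowerRelOfDegree p b W n :=
  fun _ ht u v huv => ht u v (by omega)

theorem ι_mul_mem_lowerRelOfDegree {W : List X} {n : ℕ} {t : FreeAlgebra F X}
    (ht : t ∈ lowerRelOfDegree p b W n) (i : X) :
    FreeAlgebra.ι F i * t ∈ lowerRelOfDegree p b W (n + 1) := fun u v h => by
  simpa [mul_assoc] using ht (u ++ [i]) v (by simp; omega)

theorem mul_ι_mem_lowerRelOfDegree {W : List X} {n : ℕ} {t : FreeAlgebra F X}
    (ht : t ∈ lowerRelOfDegree p b W n) (i : X) :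
    t * FreeAlgebra.ι F i ∈ lowerRelOfDegree p b W (n + 1) := fun u v h => by
  simpa [mul_assoc] using ht u (i :: v) (by simp; omega)

theorem lin_commutator_mem_lowerRelOfDegree (W : List X) (x y : L) :
    lin b x * lin b y - lin b y * lin b x - lin b ⁅x, y⁆ ∈ lowerRelOfDegree p b W 2 := by
  induction b.mem_span x using span_induction with
  | mem x hx =>
    obtain ⟨i, rfl⟩ := hx
    induction b.mem_span y using span_induction with
    | mem y hy =>
      obtain ⟨j, rfl⟩ := hy
      intro u v h
      simpa [commRel] using mul_commRel_mul_mem_lowerRel (p := p) (b := b) (u := u) (v := v)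
        (i := i) (j := j) (W := W) (.of_length_lt (by simp; omega)) (.of_length_lt (by simp; omega))
    | zero => simp
    | add y z _ _ hy hz =>
      convert add_mem hy hz using 1
      simp only [map_add, lie_add]
      noncomm_ring
    | smul c y _ hy =>
      convert smul_mem _ c hy using 1
      simp only [map_smul, lie_smul, mul_smul_comm, smul_mul_assoc, smul_sub]
  | zero => simp
  | add y z _ _ hy hz =>
    convert add_mem hy hz using 1
    simp only [map_add, add_lie]
    noncomm_ring
  | smul c y _ hy =>
    convert smul_mem _ c hy using 1
    simp only [map_smul, smul_lie, mul_smul_comm, smul_mul_assoc, smul_sub]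

theorem ad_pow_lin_mem_lowerRelOfDegree (W : List X) (j : X) (y : L) (k : ℕ) :
    ((LinearMap.mulLeft F (FreeAlgebra.ι F j) - LinearMap.mulRight F (FreeAlgebra.ι F j)) ^ k)
        (lin b y) - lin b ((LieAlgebra.ad F L (b j) ^ k) y) ∈ lowerRelOfDegree p b W (k + 1) := by
  induction k with
  | zero => simp
  | succ k ih =>
    have hcomm := lowerRelOfDegree_mono (show 2 ≤ k + 1 + 1 by omega)
      (lin_commutator_mem_lowerRelOfDegree (p := p) (b := b) W (b j)
        ((LieAlgebra.ad F L (b j) ^ k) y))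
    convert add_mem (sub_mem (ι_mul_mem_lowerRelOfDegree ih j) (mul_ι_mem_lowerRelOfDegree ih j))
      hcomm using 1
    simp only [pow_succ', Module.End.mul_apply, LinearMap.sub_apply, LinearMap.mulLeft_apply,
      LinearMap.mulRight_apply, LieAlgebra.ad_apply, lin_basis]
    noncomm_ring

theorem sum_pow_mul_mul_pow_eq (p : ℕ) [Fact p.Prime] {F A : Type*} [Field F] [CharP F p] [Ring A]
    [Algebra F A] (x y : A) :
    ∑ s ∈ Finset.range p, y ^ s * x * y ^ (p - 1 - s)
      = ((LinearMap.mulLeft F y - LinearMap.mulRight F y) ^ (p - 1)) x := by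
  rcases subsingleton_or_nontrivial A with _ | _
  · exact Subsingleton.elim _ _
  have : CharP (Module.End F A) p :=
    charP_of_injective_algebraMap (algebraMap F (Module.End F A)).injective p
  have h := Commute.sub_pow_prime_sub_one p (LinearMap.commute_mulLeft_right (R := F) y y)
  rw [h, LinearMap.sum_apply]
  simp [LinearMap.pow_mulLeft, LinearMap.pow_mulRight, mul_assoc]

/-- The key ambiguity between the commutation and the power relations. -/
theorem ι_mul_powRel_sub_mem_lowerRelOfDegree [hp : Fact p.Prime] [CharP F p] (W : List X)
    (i j : X) :
    FreeAlgebra.ι F i * powRel p b j - powRel p b j * FreeAlgebra.ι F i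
      - ∑ s ∈ Finset.range p,
          FreeAlgebra.ι F j ^ s * commRel b i j * FreeAlgebra.ι F j ^ (p - 1 - s)
      ∈ lowerRelOfDegree p b W p := by
  have had : (LieAlgebra.ad F L (b j) ^ (p - 1)) ⁅b i, b j⁆ = ⁅b i, pmap p F L (b j)⁆ := by
    rw [← lie_skew, ← lie_skew (b i), map_neg, neg_inj, ad_pOp (F := F), ← LieAlgebra.ad_apply F,
      ← Module.End.mul_apply, ← pow_succ, Nat.sub_add_cancel hp.out.one_le]
  have h1 := ad_pow_lin_mem_lowerRelOfDegree (p := p) (b := b) W j ⁅b i, b j⁆ (p - 1)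
  rw [Nat.sub_add_cancel hp.out.one_le, had, ← sum_pow_mul_mul_pow_eq] at h1
  have h2 := lowerRelOfDegree_mono hp.out.two_le
    (lin_commutator_mem_lowerRelOfDegree (p := p) (b := b) W (b i) (pmap p F L (b j)))
  convert sub_mem h1 h2 using 1
  have h3 := mul_pow_sub_pow_mul (FreeAlgebra.ι F i) (FreeAlgebra.ι F j) p
  simp only [commRel, powRel, mul_sub, sub_mul, Finset.sum_sub_distrib, lin_basis] at h3 ⊢
  rw [← h3]
  abel

theorem shortlex_append_cons {u s t : List X} {i j : X} (h : i < j) (hl : s.length = t.length) :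
    List.Shortlex (· < ·) (u ++ i :: s) (u ++ j :: t) :=
  .append_left (.of_lex (by simpa using hl) (.rel h)) u

/-- The ambiguity of the word `i j l` with `l < j < i` is resolved by the Jacobi identity. -/
theorem swap_swap_mem_lowerRel {u v : List X} {i j l : X} (hij : j < i) (hjl : l < j) :
    word F u * (FreeAlgebra.ι F i * commRel b j l - commRel b i j * FreeAlgebra.ι F l) * word F v
      ∈ lowerRel p b (u ++ (i :: j :: l :: v)) := by
  have hil := hjl.trans hij
  have h1 : word F u * commRel b i l * word F (j :: v) ∈
      lowerRel p b (u ++ (i :: j :: l :: v)) :=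
    mul_commRel_mul_mem_lowerRel
      (by simpa using shortlex_append_cons (u := u ++ [i]) (s := j :: v) (t := l :: v) hjl rfl)
      (shortlex_append_cons hil rfl)
  have h2 : word F (u ++ [l]) * commRel b i j * word F v ∈
      lowerRel p b (u ++ (i :: j :: l :: v)) :=
    mul_commRel_mul_mem_lowerRel (by rw [List.append_assoc]; exact shortlex_append_cons hil rfl)
      (by rw [List.append_assoc]; exact shortlex_append_cons hil rfl)
  have h3 : word F (u ++ [j]) * commRel b i l * word F v ∈
      lowerRel p b (u ++ (i :: j :: l :: v)) :=
    mul_commRel_mul_mem_lowerRel (by rw [List.append_assoc]; exact shortlex_append_cons hij rfl)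
      (by rw [List.append_assoc]; exact shortlex_append_cons hij rfl)
  have h4 : word F u * commRel b j l * word F (i :: v) ∈
      lowerRel p b (u ++ (i :: j :: l :: v)) :=
    mul_commRel_mul_mem_lowerRel (shortlex_append_cons hij rfl) (shortlex_append_cons hil rfl)
  have h5 := add_mem (add_mem
    (lin_commutator_mem_lowerRelOfDegree (p := p) (b := b) (u ++ (i :: j :: l :: v))
      ⁅b i, b l⁆ (b j))
    (lin_commutator_mem_lowerRelOfDegree _ (b l) ⁅b i, b j⁆))
    (lin_commutator_mem_lowerRelOfDegree _ (b i) ⁅b j, b l⁆) u v (by simp; omega)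
  have hJ : lin b ⁅⁅b i, b l⁆, b j⁆ = -lin b ⁅b l, ⁅b i, b j⁆⁆ - lin b ⁅b i, ⁅b j, b l⁆⁆ := by
    have h := lie_jacobi (b l) (b i) (b j)
    rw [← lie_skew (b l) (b i), lie_neg, lie_skew] at h
    rw [← map_neg, ← map_sub]
    congr 1
    rw [← sub_eq_zero, ← h]
    abel
  have h := neg_mem (add_mem (sub_mem (sub_mem (add_mem h1 h2) h3) h4) h5)
  convert h using 1
  simp only [lin_basis, hJ, word_append, word_cons, word_nil, commRel]
  noncomm_ring

/-- Resolution of the ambiguity of the word `i jᵖ` with `j < i`. -/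
theorem swap_pow_mem_lowerRel {q : ℕ} [RestrictedLieAlgebra (q + 2) F L] [Fact (q + 2).Prime]
    [CharP F (q + 2)] {u v : List X} {i j : X} (hij : j < i) :
    word F u * (FreeAlgebra.ι F i * powRel (q + 2) b j
        - commRel b i j * FreeAlgebra.ι F j ^ (q + 1)) * word F v
      ∈ lowerRel (q + 2) b (u ++ (i :: (List.replicate (q + 2) j ++ v))) := by
  have h1 := ι_mul_powRel_sub_mem_lowerRelOfDegree (p := q + 2) (b := b)
    (u ++ (i :: (List.replicate (q + 2) j ++ v))) i j u v (by simp; omega)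
  have h2 : word F u * powRel (q + 2) b j * word F (i :: v) ∈
      lowerRel (q + 2) b (u ++ (i :: (List.replicate (q + 2) j ++ v))) :=
    mul_powRel_mul_mem_lowerRel (shortlex_append_cons hij (by simp; omega))
  have h3 : ∀ s ∈ Finset.range (q + 1), word F (u ++ List.replicate (s + 1) j) * commRel b i j *
      word F (List.replicate (q + 1 - (s + 1)) j ++ v) ∈
      lowerRel (q + 2) b (u ++ (i :: (List.replicate (q + 2) j ++ v))) := by
    intro s hs
    have hs := Finset.mem_range.mp hs
    refine mul_commRel_mul_mem_lowerRel ?_ ?_ <;>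
    · rw [List.append_assoc]
      exact shortlex_append_cons hij (by simp; omega)
  convert add_mem (add_mem h1 h2) (sum_mem h3) using 1
  simp only [word_append, word_replicate, word_cons]
  rw [Finset.sum_range_succ']
  simp only [mul_sub, sub_mul, mul_add, add_mul, Finset.mul_sum, Finset.sum_mul, mul_assoc,
    pow_zero, one_mul, show q + 2 - 1 = q + 1 from rfl, Nat.sub_zero]
  abel

/-- Resolution of the ambiguity of the word `iᵖ l` with `l < i`. -/
theorem pow_swap_mem_lowerRel {q : ℕ} [RestrictedLieAlgebra (q + 2) F L] [Fact (q + 2).Prime]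
    [CharP F (q + 2)] {u v : List X} {i l : X} (hil : l < i) :
    word F u * (FreeAlgebra.ι F i ^ (q + 1) * commRel b i l
        - powRel (q + 2) b i * FreeAlgebra.ι F l) * word F v
      ∈ lowerRel (q + 2) b (u ++ (List.replicate (q + 2) i ++ l :: v)) := by
  have h1 := ι_mul_powRel_sub_mem_lowerRelOfDegree (p := q + 2) (b := b)
    (u ++ (List.replicate (q + 2) i ++ l :: v)) l i u v (by simp; omega)
  have h2 : word F (u ++ [l]) * powRel (q + 2) b i * word F v ∈
      lowerRel (q + 2) b (u ++ (List.replicate (q + 2) i ++ l :: v)) :=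
    mul_powRel_mul_mem_lowerRel (by
      rw [List.append_assoc]
      exact shortlex_append_cons hil (by simp; omega))
  have h3 : ∀ s ∈ Finset.range (q + 1), word F (u ++ List.replicate s i) * commRel b l i *
      word F (List.replicate (q + 1 - s) i ++ v) ∈
      lowerRel (q + 2) b (u ++ (List.replicate (q + 2) i ++ l :: v)) := by
    intro s hs
    have hs := Finset.mem_range.mp hs
    obtain ⟨m, rfl⟩ : ∃ m, q = s + m := ⟨q - s, by omega⟩
    have hw : u ++ (List.replicate (s + m + 2) i ++ l :: v)
        = u ++ List.replicate s i ++ i :: i :: (List.replicate m i ++ l :: v) := by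
      rw [show s + m + 2 = s + (m + 2) by omega, List.replicate_add]
      simp [List.replicate_succ]
    rw [hw]
    refine mul_commRel_mul_mem_lowerRel ?_ ?_
    · exact shortlex_append_cons hil (by simp; omega)
    · have h := shortlex_append_cons (u := u ++ List.replicate s i ++ [i])
        (s := List.replicate (s + m + 1 - s) i ++ v) (t := List.replicate m i ++ l :: v) hil
        (by simp; omega)
      simpa using h
  convert add_mem (sub_mem h1 h2) (sum_mem h3) using 1
  simp only [word_append, word_replicate, word_cons, word_nil]
  rw [Finset.sum_range_succ, ← neg_commRel b l i]
  simp only [mul_sub, sub_mul, mul_add, add_mul, Finset.mul_sum, Finset.sum_mul, mul_assoc,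
    pow_zero, mul_one, show q + 2 - 1 = q + 1 from rfl, Nat.sub_self, mul_neg, neg_mul]
  abel

/-- Resolution of the overlaps of the power rule of a letter with itself. -/
theorem pow_pow_mem_lowerRel [hp : Fact p.Prime] {u v : List X} {i : X} (s : ℕ) :
    word F u * (FreeAlgebra.ι F i ^ s * powRel p b i
        - powRel p b i * FreeAlgebra.ι F i ^ s) * word F v
      ∈ lowerRel p b (u ++ (List.replicate (s + p) i ++ v)) := by
  have hz : ⁅pmap p F L (b i), b i⁆ = 0 := by
    obtain ⟨q, hq⟩ : ∃ q, p = q + 1 := ⟨p - 1, by have := hp.out.one_lt; omega⟩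
    have h := ad_pOp (p := p) (F := F) (b i) (b i)
    rw [show (LieAlgebra.ad F L (b i) ^ p) (b i) = 0 by
      rw [hq, pow_succ, Module.End.mul_apply, LieAlgebra.ad_apply, lie_self, map_zero]] at h
    exact h
  have h1 := lin_commutator_mem_lowerRelOfDegree (p := p) (b := b)
    (u ++ (List.replicate (s + p) i ++ v)) (pmap p F L (b i)) (b i)
  rw [hz, map_zero, sub_zero, lin_basis] at h1
  have h2 : ∀ k ∈ Finset.range s, word F (u ++ List.replicate k i) *
      (lin b (pmap p F L (b i)) * FreeAlgebra.ι F i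
        - FreeAlgebra.ι F i * lin b (pmap p F L (b i))) *
      word F (List.replicate (s - 1 - k) i ++ v) ∈
      lowerRel p b (u ++ (List.replicate (s + p) i ++ v)) := by
    intro k hk
    have hk := Finset.mem_range.mp hk
    have := hp.out.two_le
    exact h1 _ _ (by simp; omega)
  convert sum_mem h2 using 1
  have h3 := mul_pow_sub_pow_mul (lin b (pmap p F L (b i))) (FreeAlgebra.ι F i) s
  have h4 : FreeAlgebra.ι F i ^ s * powRel p b i - powRel p b i * FreeAlgebra.ι F i ^ s
      = lin b (pmap p F L (b i)) * FreeAlgebra.ι F i ^ s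
        - FreeAlgebra.ι F i ^ s * lin b (pmap p F L (b i)) := by
    rw [powRel, mul_sub, sub_mul, ← pow_add, ← pow_add, add_comm s p]
    abel
  rw [h4, h3, Finset.mul_sum, Finset.sum_mul]
  simp [mul_assoc]

/-- Resolution of the overlap of two basic rules. -/
theorem overlap_mem_lowerRel [hp : Fact p.Prime] [CharP F p] {u c d v w v' : List X}
    {f g : FreeAlgebra F X} (hf : BasicRule p b (c ++ d) f) (hg : BasicRule p b w g)
    (hd : d ≠ []) (h : d ++ v = w ++ v') :
    word F u * (word F c * (word F w - g) * word F v' - (word F (c ++ d) - f) * word F v)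
      ∈ lowerRel p b (u ++ (c ++ (d ++ v))) := by
  obtain ⟨q, rfl⟩ : ∃ q, p = q + 2 := ⟨p - 2, by have := hp.out.two_le; omega⟩
  generalize hcd : c ++ d = cd at hf
  cases hf with
  | @swap i j hij =>
    obtain ⟨rfl, rfl⟩ | ⟨rfl, rfl⟩ : (c = [] ∧ d = [i, j]) ∨ (c = [i] ∧ d = [j]) := by
      rcases c with _ | ⟨k, _ | ⟨l, c⟩⟩ <;> simp_all
    · cases hg with
      | @swap k l hkl =>
        obtain ⟨rfl, rfl, rfl⟩ : i = k ∧ j = l ∧ v = v' := by simpa using h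
        simp
      | pow k =>
        simp only [List.replicate_succ, List.cons_append, List.nil_append,
          List.cons.injEq] at h
        exact absurd (h.1.trans h.2.1.symm) hij.ne'
    · cases hg with
      | @swap k l hkl =>
        obtain ⟨rfl, rfl⟩ : j = k ∧ v = l :: v' := by simpa using h
        change _ ∈ lowerRel (q + 2) b (u ++ (i :: j :: l :: v'))
        convert swap_swap_mem_lowerRel (p := q + 2) (b := b) (u := u) (v := v') hij hkl using 1
        simp only [word_cons, word_nil, commRel]
        noncomm_ring
      | pow k =>
        simp only [List.replicate_succ, List.cons_append, List.nil_append,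
            List.cons.injEq] at h
        obtain ⟨rfl, rfl⟩ := h
        change _ ∈ lowerRel (q + 2) b (u ++ (i :: (List.replicate (q + 2) j ++ v')))
        convert swap_pow_mem_lowerRel (b := b) (u := u) (v := v') hij using 1
        simp only [word_cons, word_nil, word_append, word_replicate, commRel, powRel, pow_succ']
        noncomm_ring
  | pow i =>
    obtain ⟨hlen, hc, hd'⟩ := List.append_eq_replicate_iff.mp hcd
    obtain ⟨t, ht⟩ : ∃ t, d.length = t + 1 :=
      Nat.exists_eq_succ_of_ne_zero (by simpa using hd)
    rw [ht] at hd' hlen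
    generalize c.length = s at hc hlen
    subst hc hd'
    cases hg with
    | @swap k l hkl =>
      cases t with
      | zero =>
        obtain rfl : s = q + 1 := by omega
        obtain ⟨rfl, rfl⟩ : i = k ∧ v = l :: v' := by simpa using h
        convert pow_swap_mem_lowerRel (b := b) (u := u) (v := v') hkl using 1
        · simp [List.replicate_succ']
        · simp only [word_cons, word_nil, word_replicate, commRel, powRel]
          noncomm_ring
      | succ t =>
        simp only [List.replicate_succ, List.cons_append, List.nil_append,
          List.cons.injEq] at h
        exact absurd (h.1.symm.trans h.2.1) hkl.ne'
    | pow k =>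
      obtain rfl : i = k := by
        simp only [List.replicate_succ, List.cons_append, List.cons.injEq] at h
        exact h.1
      obtain rfl : v = List.replicate s i ++ v' := by
        rw [show q + 2 = t + 1 + s by omega, List.replicate_add (t + 1) s, List.append_assoc] at h
        exact List.append_cancel_left h
      convert pow_pow_mem_lowerRel (p := q + 2) (b := b) (u := u) (v := v') (i := i) s using 1
      · rw [← List.append_assoc (List.replicate (t + 1) i), List.replicate_append_replicate,
          ← List.append_assoc (List.replicate s i), List.replicate_append_replicate,
          show t + 1 + s = q + 2 by omega]
      · simp only [word_append, word_replicate, powRel]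
        noncomm_ring

theorem Rule.sub_mem_lowerRel [Fact p.Prime] [CharP F p] {w : List X} {f g : FreeAlgebra F X}
    (hf : Rule p b w f) (hg : Rule p b w g) : f - g ∈ lowerRel p b w := by
  obtain ⟨u, x, v, f, hf, rfl, rfl⟩ := hf
  obtain ⟨u', x', v', g, hg, h, rfl⟩ := hg
  have key : ∀ {u x v c x' v' : List X} {f g : FreeAlgebra F X}, BasicRule p b x f →
      BasicRule p b x' g → x ++ v = c ++ (x' ++ v') →
      word F u * f * word F v - word F (u ++ c) * g * word F v'
        ∈ lowerRel p b (u ++ (x ++ v)) := by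
    clear * -
    intro u x v c x' v' f g hf hg h
    have disjoint (d : List X) (hv : v = d ++ (x' ++ v')) (hc : c = x ++ d) :
        word F u * f * word F v - word F (u ++ c) * g * word F v'
          ∈ lowerRel p b (u ++ (x ++ v)) := by
      subst hv hc
      convert sub_mem (mul_mul_mem_lowerRel_right (u := u) (c := d) (v := v') hg hf.mem_span)
        (mul_mul_mem_lowerRel_left (u := u) (c := d) (v := v') hf hg.mem_span) using 1
      simp only [word_append]
      noncomm_ring
    rcases List.append_eq_append_iff.mp h with ⟨d, hc, hv⟩ | ⟨d, rfl, h'⟩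
    · exact disjoint d hv hc
    · by_cases hd : d = []
      · subst hd
        exact disjoint [] h'.symm (by simp)
      · have := overlap_mem_lowerRel (u := u) hf hg hd h'.symm
        rw [List.append_assoc]
        convert this using 1
        have hw : word F d * word F v = word F x' * word F v' := by
          rw [← word_append, ← word_append, h']
        simp only [word_append, mul_sub, sub_mul, mul_assoc, hw]
        abel
  rcases List.append_eq_append_iff.mp h with ⟨c, rfl, hc⟩ | ⟨c, rfl, hc⟩
  · exact key hf hg hc
  · rw [← neg_sub, h]
    exact neg_mem (key hg hf hc)

theorem BasicRule.two_le_length [hp : Fact p.Prime] {w : List X} {f : FreeAlgebra F X}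
    (hf : BasicRule p b w f) : 2 ≤ w.length := by
  cases hf with
  | swap h => simp
  | pow i => simpa using hp.out.two_le

theorem Rule.two_le_length [Fact p.Prime] {w : List X} {f : FreeAlgebra F X}
    (hf : Rule p b w f) : 2 ≤ w.length := by
  obtain ⟨u, x, v, f, hf, rfl, rfl⟩ := hf
  have := hf.two_le_length
  simp only [List.length_append]
  omega

theorem exists_linearMap_freeAlgebra [Fact p.Prime] [CharP F p] [WellFoundedLT X] {A : Type*}
    [AddCommGroup A] [Module F A] (b : Basis X F L) (π : L →ₗ[F] A) :
    ∃ φ : FreeAlgebra F X →ₗ[F] A, (∀ x, φ (lin b x) = π x) ∧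
      (∀ w : List X, 2 ≤ w.length → (∀ f, ¬ Rule p b w f) → φ (word F w) = 0) ∧
      ∀ w f, Rule p b w f → φ (word F w) = φ f := by
  obtain ⟨φ, hirr, hrule⟩ := exists_linearMap_of_confluent (wordBasis F X)
    (List.Shortlex.wf (wellFounded_lt (α := X))) (Rule p b) (fun _ _ h => h.mem_span)
    (fun _ _ _ hf hg => hf.sub_mem_lowerRel hg)
    (fun w : List X => match w with | [i] => π (b i) | _ => 0)
  simp only [wordBasis_apply] at hirr hrule
  refine ⟨φ, fun x => ?_, fun w hw hirr' => ?_, hrule⟩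
  · suffices φ ∘ₗ lin b = π from LinearMap.congr_fun this x
    refine b.ext fun i => ?_
    have := hirr [i] fun f hf => by simpa using hf.two_le_length
    simpa using this
  · rw [hirr w hirr']
    match w, hw with
    | _ :: _ :: _, _ => rfl

/-- If the letters of a restricted subalgebra come first, then the words of length at least two
starting with such a letter are killed, provided that brackets and `p`-th powers are. -/
theorem linearMap_word_cons_eq_zero [hp : Fact p.Prime] [WellFoundedLT X] {A : Type*}
    [AddCommGroup A] [Module F A] {π : L →ₗ[F] A} {φ : FreeAlgebra F X →ₗ[F] A}
    (hlin : ∀ x, φ (lin b x) = π x)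
    (hirr : ∀ w : List X, 2 ≤ w.length → (∀ f, ¬ Rule p b w f) → φ (word F w) = 0)
    (hrule : ∀ w f, Rule p b w f → φ (word F w) = φ f)
    {s : Set X} (hs : IsLowerSet s)
    (hlie : ∀ i ∈ s, ∀ j ∈ s, ⁅b i, b j⁆ ∈ span F (b '' s) ⊓ LinearMap.ker π)
    (hpow : ∀ i ∈ s, pmap p F L (b i) ∈ span F (b '' s) ⊓ LinearMap.ker π)
    (W : List X) : ∀ i w, W = i :: w → w ≠ [] → i ∈ s → φ (word F W) = 0 := by
  induction W using (List.Shortlex.wf (wellFounded_lt (α := X))).induction with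
  | _ W ih =>
    intro i w hW hw hi
    have inner (u v : List X) (x : L) (h : (i :: u).length + v.length + 1 < W.length) :
        φ (word F (i :: u) * lin b x * word F v) = 0 := by
      induction b.mem_span x using span_induction with
      | mem x hx =>
        obtain ⟨k, rfl⟩ := hx
        have := ih (i :: (u ++ k :: v)) (.of_length_lt (by simp at h ⊢; omega)) i _ rfl (by simp) hi
        simpa [mul_assoc] using this
      | zero => simp
      | add x y _ _ hx hy => rw [map_add, mul_add, add_mul, map_add, hx, hy, add_zero]
      | smul c x _ hx => rw [map_smul, mul_smul_comm, smul_mul_assoc, map_smul, hx, smul_zero]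
    have outer (v : List X) (x : L) (hx : x ∈ span F (b '' s) ⊓ LinearMap.ker π)
        (h : v.length + 1 < W.length) : φ (lin b x * word F v) = 0 := by
      rcases eq_or_ne v [] with rfl | hv
      · simpa [hlin] using hx.2
      · have hx' := hx.1
        clear hx
        induction hx' using span_induction with
        | mem x hx =>
          obtain ⟨k, hk, rfl⟩ := hx
          simpa using ih (k :: v) (.of_length_lt (by simpa using h)) k v rfl hv hk
        | zero => simp
        | add x y _ _ hx hy => rw [map_add, add_mul, map_add, hx, hy, add_zero]
        | smul c x _ hx => rw [map_smul, smul_mul_assoc, map_smul, hx, smul_zero]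
    by_cases hW' : ∃ f, Rule p b W f
    · obtain ⟨f, hf⟩ := hW'
      rw [hrule W f hf]
      obtain ⟨u, x, v, f, hf, hWu, rfl⟩ := hf
      rcases u with _ | ⟨i', u⟩
      · cases hf with
        | @swap k j hjk =>
          obtain ⟨rfl, rfl⟩ : i = k ∧ w = j :: v := by simpa using hW.symm.trans hWu
          have hj := hs hjk.le hi
          have h1 := ih (j :: i :: v) (by subst hW; exact .of_lex rfl (.rel hjk)) j _ rfl
            (by simp) hj
          have h2 := outer v _ (hlie i hi j hj) (by simp [hW])
          simp only [word_nil, one_mul, add_mul, map_add, h2, add_zero]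
          simpa [mul_assoc] using h1
        | pow k =>
          have hp2 := hp.out.two_le
          obtain rfl : i = k := by
            have h := congrArg List.head? (hW.symm.trans hWu)
            simpa [List.head?_append, List.head?_replicate, hp.out.ne_zero] using h
          simpa using outer v _ (hpow i hi) (by simp [hWu]; omega)
      · obtain ⟨rfl, rfl⟩ : i = i' ∧ w = u ++ (x ++ v) := by simpa using hW.symm.trans hWu
        cases hf with
        | @swap k j hjk =>
          have h1 := ih (i :: (u ++ (j :: k :: v))) (by
            subst hW
            exact shortlex_append_cons (u := i :: u) hjk rfl) i _ rfl
            (by simp) hi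
          have h2 := inner u v ⁅b k, b j⁆ (by simp [hW]; omega)
          rw [mul_add, add_mul, map_add, h2, add_zero]
          simpa [mul_assoc] using h1
        | pow k =>
          have hp2 := hp.out.two_le
          exact inner u v _ (by simp [hW]; omega)
    · refine hirr W ?_ (by simpa using hW')
      subst hW
      have := List.length_pos_iff.mpr hw
      simp only [List.length_cons]
      omega

end Rewriting


section Functional

variable {p : ℕ} {F L X : Type*} [Field F] [LieRing L] [LieAlgebra F L]
  [RestrictedLieAlgebra p F L] {b : Basis X F L}

/-- The presentation of `u(L)` by generators and relations attached to a basis of `L`. -/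
theorem exists_algHom_uEnv [hp : Fact p.Prime] {Q : Type*} [Ring Q] [Algebra F Q]
    (ψ : FreeAlgebra F X →ₐ[F] Q) (hcomm : ∀ i j, ψ (commRel b i j) = 0)
    (hpow : ∀ i, ψ (powRel p b i) = 0) :
    ∃ g : uEnv p F L →ₐ[F] Q, ∀ x, g (uemb p F L x) = ψ (lin b x) := by
  have hlie (x y : L) : ψ (lin b ⁅x, y⁆) = ⁅ψ (lin b x), ψ (lin b y)⁆ := by
    induction b.mem_span x using span_induction with
    | mem x hx =>
      obtain ⟨i, rfl⟩ := hx
      induction b.mem_span y using span_induction with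
      | mem y hy =>
        obtain ⟨j, rfl⟩ := hy
        have := hcomm i j
        rw [commRel, map_sub, sub_eq_zero] at this
        rw [← this, Ring.lie_def]
        simp
      | zero => simp
      | add x y _ _ hx hy => simp only [lie_add, map_add, hx, hy]
      | smul c x _ hx => rw [lie_smul, map_smul, map_smul, hx, map_smul, map_smul, Ring.lie_def,
          Ring.lie_def, smul_sub, mul_smul_comm, smul_mul_assoc]
    | zero => simp
    | add x y _ _ hx hy => simp only [add_lie, map_add, hx, hy]
    | smul c x _ hx => simp only [smul_lie, map_smul, hx]
  let h : L →ₗ⁅F⁆ Q := { ψ.toLinearMap ∘ₗ lin b with map_lie' := hlie _ _ }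
  have hh (x : L) : h x = ψ (lin b x) := rfl
  have hp' (x : L) : h x ^ p = h (pmap p F L x) := by
    induction b.mem_span x using span_induction with
    | mem x hx =>
      obtain ⟨i, rfl⟩ := hx
      have := hpow i
      rw [powRel, map_sub, sub_eq_zero] at this
      simp [hh, ← this]
    | zero =>
      have := pOp_smul (p := p) (0 : F) (0 : L)
      rw [zero_smul, zero_pow hp.out.ne_zero, zero_smul] at this
      simp [pmap, this, hp.out.ne_zero]
    | add x y _ _ hx hy =>
      have := congrArg (UniversalEnvelopingAlgebra.lift F h) (pOp_add (p := p) (F := F) x y)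
      simp only [map_sub, map_pow, map_add, UniversalEnvelopingAlgebra.lift_ι_apply, hx, hy,
        sub_left_inj] at this
      rw [map_add, ← this]
    | smul c x _ hx => rw [pmap, pOp_smul, map_smul, smul_pow, hx, map_smul]
  refine ⟨RingQuot.liftAlgHom F ⟨UniversalEnvelopingAlgebra.lift F h, ?_⟩, fun x => ?_⟩
  · rintro _ _ ⟨x, rfl, rfl⟩
    simp [hp']
  · simp [uemb, hh]

/-- The largest two-sided ideal on which a linear map on an algebra and a character vanish. -/
def vanishingIdeal {T A : Type*} [Ring T] [Algebra F T] [AddCommGroup A] [Module F A]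
    (φ : T →ₗ[F] A) (ε : T →ₐ[F] F) : Ideal T where
  carrier := {t | (∀ a c, φ (a * t * c) = 0) ∧ ε t = 0}
  add_mem' h h' := ⟨fun a c => by rw [mul_add, add_mul, map_add, h.1, h'.1, add_zero],
    by rw [map_add, h.2, h'.2, add_zero]⟩
  zero_mem' := by simp
  smul_mem' d t h := ⟨fun a c => by simpa only [smul_eq_mul, ← mul_assoc] using h.1 (a * d) c,
    by rw [smul_eq_mul, map_mul, h.2, mul_zero]⟩

instance {T A : Type*} [Ring T] [Algebra F T] [AddCommGroup A] [Module F A]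
    (φ : T →ₗ[F] A) (ε : T →ₐ[F] F) : (vanishingIdeal φ ε).IsTwoSided where
  mul_mem_of_left d h := ⟨fun a c => by simpa only [← mul_assoc] using h.1 a (d * c),
    by rw [map_mul, h.2, zero_mul]⟩

theorem map_mul_mul_eq_zero_of_word {A : Type*} [AddCommGroup A] [Module F A]
    {φ : FreeAlgebra F X →ₗ[F] A} {t : FreeAlgebra F X}
    (h : ∀ u v, φ (word F u * t * word F v) = 0) (a c : FreeAlgebra F X) :
    φ (a * t * c) = 0 := by
  induction (wordBasis F X).mem_span a using span_induction with
  | mem a ha =>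
    obtain ⟨u, rfl⟩ := ha
    induction (wordBasis F X).mem_span c using span_induction with
    | mem c hc =>
      obtain ⟨v, rfl⟩ := hc
      simpa using h u v
    | zero => simp
    | add x y _ _ hx hy => rw [mul_add, map_add, hx, hy, add_zero]
    | smul r x _ hx => rw [mul_smul_comm, map_smul, hx, smul_zero]
  | zero => simp
  | add x y _ _ hx hy => rw [add_mul, add_mul, map_add, hx, hy, add_zero]
  | smul r x _ hx => rw [smul_mul_assoc, smul_mul_assoc, map_smul, hx, smul_zero]

theorem lift_zero_lin (x : L) : FreeAlgebra.lift F (0 : X → F) (lin b x) = 0 := by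
  have : (FreeAlgebra.lift F (0 : X → F)).toLinearMap ∘ₗ lin b = 0 := b.ext fun i => by simp
  exact LinearMap.congr_fun this x

/-- If the letters of a restricted subalgebra come first, a linear map on `L` killing its brackets
and `p`-th powers extends to `u(L)`, with the expected values on products with its elements. -/
theorem exists_linearMap_uEnv [hp : Fact p.Prime] [CharP F p] [LinearOrder X] [WellFoundedLT X]
    {A : Type*} [AddCommGroup A] [Module F A] (b : Basis X F L) (π : L →ₗ[F] A)
    {s : Set X} (hs : IsLowerSet s)
    (hlie : ∀ i ∈ s, ∀ j ∈ s, ⁅b i, b j⁆ ∈ span F (b '' s) ⊓ LinearMap.ker π)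
    (hpow : ∀ i ∈ s, pmap p F L (b i) ∈ span F (b '' s) ⊓ LinearMap.ker π) :
    ∃ f : uEnv p F L →ₗ[F] A, (∀ x, f (uemb p F L x) = π x) ∧
      ∀ n ∈ span F (b '' s), ∀ u, f (uemb p F L n * u) = aug p F L u • π n := by
  obtain ⟨φ, hlin, hirr, hrule⟩ := exists_linearMap_freeAlgebra (p := p) b π
  have hcons := linearMap_word_cons_eq_zero hlin hirr hrule hs hlie hpow
  set ε := FreeAlgebra.lift F (0 : X → F) with hε
  have hbasic {w : List X} {t : FreeAlgebra F X} (h : BasicRule p b w t) (a c : FreeAlgebra F X) :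
      φ (a * (word F w - t) * c) = 0 := by
    refine map_mul_mul_eq_zero_of_word (fun u v => ?_) a c
    have := hrule _ _ ⟨u, w, v, t, h, rfl, rfl⟩
    rw [mul_sub, sub_mul, map_sub, ← this, sub_eq_zero]
    simp [mul_assoc]
  set J := vanishingIdeal φ ε with hJ
  have hcommJ_of_lt {i j : X} (h : j < i) : commRel b i j ∈ J := by
    refine ⟨fun a c => ?_, by simp [commRel, hε, lift_zero_lin]⟩
    simpa [commRel, sub_sub] using hbasic (.swap h) a c
  have hcommJ (i j : X) : commRel b i j ∈ J := by
    rcases lt_trichotomy i j with h | rfl | h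
    · rw [← neg_commRel]
      exact J.neg_mem (hcommJ_of_lt h)
    · simp [commRel]
    · exact hcommJ_of_lt h
  have hpowJ (i : X) : powRel p b i ∈ J := by
    refine ⟨fun a c => ?_, by simp [powRel, hε, lift_zero_lin, hp.out.ne_zero]⟩
    simpa [powRel] using hbasic (.pow i) a c
  obtain ⟨g, hg⟩ := exists_algHom_uEnv (p := p) (b := b) (Ideal.Quotient.mkₐ F J)
    (fun i j => Ideal.Quotient.eq_zero_iff_mem.mpr (hcommJ i j))
    (fun i => Ideal.Quotient.eq_zero_iff_mem.mpr (hpowJ i))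
  let φ' : (FreeAlgebra F X ⧸ J) →ₗ[F] A :=
    (J.restrictScalars F).liftQ φ (fun t ht => by
      simpa using (show t ∈ J from ht).1 1 1) ∘ₗ
      (Submodule.Quotient.restrictScalarsEquiv F J).symm.toLinearMap
  have hφ' (t : FreeAlgebra F X) : φ' (Ideal.Quotient.mkₐ F J t) = φ t := rfl
  let ε' : (FreeAlgebra F X ⧸ J) →ₐ[F] F := Ideal.Quotient.liftₐ J ε fun t ht => ht.2
  have hε' (t : FreeAlgebra F X) : ε' (Ideal.Quotient.mkₐ F J t) = ε t := rfl
  have haug : ε'.comp g = aug p F L := by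
    refine RingQuot.ringQuot_ext' _ _ _
      (UniversalEnvelopingAlgebra.hom_ext F (LieHom.ext fun x => ?_))
    have : ε' (g (uemb p F L x)) = 0 := by rw [hg, hε', hε, lift_zero_lin]
    simpa [aug, uemb] using this
  have hφε {i : X} (hi : i ∈ s) (t : FreeAlgebra F X) :
      φ (FreeAlgebra.ι F i * t) = ε t • π (b i) := by
    induction (wordBasis F X).mem_span t using span_induction with
    | mem t ht =>
      obtain ⟨w, rfl⟩ := ht
      rcases w with _ | ⟨j, w⟩
      · simp [← hlin]
      · simpa [hε] using hcons _ i (j :: w) rfl (by simp) hi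
    | zero => simp
    | add x y _ _ hx hy => rw [mul_add, map_add, hx, hy, map_add, add_smul]
    | smul r x _ hx => rw [mul_smul_comm, map_smul, hx, map_smul, smul_assoc]
  refine ⟨φ' ∘ₗ g.toLinearMap, fun x => ?_, fun n hn u => ?_⟩
  · rw [LinearMap.comp_apply, AlgHom.toLinearMap_apply, hg, hφ', hlin]
  · obtain ⟨t, ht⟩ := Ideal.Quotient.mkₐ_surjective F J (g u)
    have hu : aug p F L u = ε t := by
      rw [← haug, AlgHom.comp_apply, ← ht, hε']
    rw [LinearMap.comp_apply, AlgHom.toLinearMap_apply, map_mul, hg, ← ht, ← map_mul, hφ', hu]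
    induction hn using span_induction with
    | mem n hn =>
      obtain ⟨i, hi, rfl⟩ := hn
      rw [lin_basis, hφε hi]
    | zero => simp
    | add x y _ _ hx hy => rw [map_add, add_mul, map_add, hx, hy, map_add, smul_add]
    | smul r x _ hx => rw [map_smul, smul_mul_assoc, map_smul, hx, map_smul, smul_comm]

theorem uemb_pmap (x : L) : uemb p F L (pmap p F L x) = uemb p F L x ^ p := by
  simpa [uemb] using (RingQuot.mkAlgHom_rel F (s := uRel p F L) ⟨x, rfl, rfl⟩).symm

theorem aug_uemb [Fact p.Prime] (x : L) : aug p F L (uemb p F L x) = 0 := by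
  simp [aug, uemb]

end Functional

end RestrictedLieAlgebra

/-- A subspace is spanned by an initial segment of some well-ordered basis. -/
theorem Submodule.exists_basis_isLowerSet.{u, v} {F : Type v} {V : Type u} [Field F]
    [AddCommGroup V] [Module F V] (N : Submodule F V) :
    ∃ (X : Type u) (_ : LinearOrder X) (_ : WellFoundedLT X) (b : Module.Basis X F V) (s : Set X),
      IsLowerSet s ∧ Submodule.span F (b '' s) = N := by
  obtain ⟨C, hC⟩ := N.exists_isCompl
  let bN := Module.Basis.ofVectorSpace F N
  let bC := Module.Basis.ofVectorSpace F C
  obtain ⟨_, _⟩ := exists_wellFoundedLT (α := Module.Basis.ofVectorSpaceIndex F N)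
  obtain ⟨_, _⟩ := exists_wellFoundedLT (α := Module.Basis.ofVectorSpaceIndex F C)
  let b := ((bN.prod bC).map (Submodule.prodEquivOfIsCompl N C hC)).reindex toLex
  have hb : b '' Set.range Sum.inlₗ = N.subtype '' Set.range bN := by
    rw [← Set.range_comp, ← Set.range_comp]
    congr 1
    ext i
    simp [b, Sum.inlₗ]
  refine ⟨_, inferInstance, ⟨Sum.lex_wf wellFounded_lt wellFounded_lt⟩, b,
    Set.range Sum.inlₗ, ?_, ?_⟩
  · rintro _ y h ⟨i, rfl⟩
    rcases y with j | j
    · exact ⟨j, rfl⟩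
    · exact absurd h Sum.Lex.not_inr_le_inl
  · rw [hb, ← Submodule.map_span, bN.span_eq, Submodule.map_subtype_top]

open RestrictedLieAlgebra in
/-- For a restricted subalgebra `N` of `L`, inside `u(L)` one has
`L ∩ ([N,L] + Nω(L)) = [N,L] + N^p`. -/
theorem L_inter_bracket_add_Nomega
    (p : ℕ) (F L : Type*) [Field F] [Fact p.Prime] [CharP F p]
    [LieRing L] [LieAlgebra F L] [RestrictedLieAlgebra p F L]
    (N : LieSubalgebra F L) (hN : ∀ x ∈ N, pmap p F L x ∈ N) :
    lSub p F L ⊓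
        (Submodule.span F {z : uEnv p F L | ∃ n ∈ N, ∃ x : L, z = uemb p F L ⁅n, x⁆}
          + (N.toSubmodule.map (uemb p F L)) * omegaIdeal p F L)
      = Submodule.span F {z : uEnv p F L | ∃ n ∈ N, ∃ x : L, z = uemb p F L ⁅n, x⁆}
          + ((subPPow p F N).toSubmodule.map (uemb p F L)) := by
  have hspan : Submodule.span F {z : uEnv p F L | ∃ n ∈ N, ∃ x : L, z = uemb p F L ⁅n, x⁆}
      = (Submodule.span F {z : L | ∃ n ∈ N, ∃ x : L, z = ⁅n, x⁆}).map (uemb p F L) := by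
    rw [Submodule.map_span]
    congr 1
    ext z
    constructor
    · rintro ⟨n, hn, x, rfl⟩
      exact ⟨_, ⟨n, hn, x, rfl⟩, rfl⟩
    · rintro ⟨_, ⟨n, hn, x, rfl⟩, rfl⟩
      exact ⟨n, hn, x, rfl⟩
  set B := Submodule.span F {z : L | ∃ n ∈ N, ∃ x : L, z = ⁅n, x⁆}
  have hlieB {n : L} (hn : n ∈ N) (x : L) : ⁅n, x⁆ ∈ B := Submodule.subset_span ⟨n, hn, x, rfl⟩
  rw [hspan, Submodule.add_eq_sup, Submodule.add_eq_sup, ← Submodule.map_sup]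
  apply le_antisymm
  · rintro _ ⟨⟨y, rfl⟩, hy⟩
    set I := B ⊔ (subPPow p F N).toSubmodule
    have hpowI {n : L} (hn : n ∈ N) : pmap p F L n ∈ I := by
      refine Submodule.mem_sup_right ?_
      rw [LieSubalgebra.mem_toSubmodule, subPPow, restrictedClosure, ← SetLike.mem_coe,
        LieSubalgebra.coe_sInf, Set.mem_iInter₂]
      exact fun K hK => hK.1 ⟨n, hn, rfl⟩
    obtain ⟨X, _, _, b, s, hs, hbs⟩ := N.toSubmodule.exists_basis_isLowerSet
    have hsN {i : X} (hi : i ∈ s) : b i ∈ N := by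
      rw [← LieSubalgebra.mem_toSubmodule, ← hbs]
      exact Submodule.subset_span ⟨i, hi, rfl⟩
    obtain ⟨f, hf, hfω⟩ := exists_linearMap_uEnv (p := p) b I.mkQ hs
      (fun i hi j hj => by
        rw [hbs, Submodule.ker_mkQ]
        exact ⟨N.lie_mem (hsN hi) (hsN hj), Submodule.mem_sup_left (hlieB (hsN hi) _)⟩)
      (fun i hi => by
        rw [hbs, Submodule.ker_mkQ]
        exact ⟨hN _ (hsN hi), hpowI (hsN hi)⟩)
    rw [hbs] at hfω
    refine ⟨y, ?_, rfl⟩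
    rw [SetLike.mem_coe, ← Submodule.ker_mkQ I, LinearMap.mem_ker, ← hf]
    suffices B.map (uemb p F L) ⊔ N.toSubmodule.map (uemb p F L) * omegaIdeal p F L
      ≤ LinearMap.ker f from this hy
    refine sup_le ?_ (Submodule.mul_le.mpr ?_)
    · rintro _ ⟨x, hx, rfl⟩
      rw [LinearMap.mem_ker, hf, ← LinearMap.mem_ker, Submodule.ker_mkQ]
      exact Submodule.mem_sup_left hx
    · rintro _ ⟨n, hn, rfl⟩ u hu
      have hu : aug p F L u = 0 := hu
      rw [LinearMap.mem_ker, hfω n hn, hu, zero_smul]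
  · refine le_inf LinearMap.map_le_range (Submodule.map_le_iff_le_comap.mpr (sup_le ?_ ?_))
    · exact Submodule.map_le_iff_le_comap.mp le_sup_left
    set M := B.map (uemb p F L) ⊔ N.toSubmodule.map (uemb p F L) * omegaIdeal p F L
    let K : LieSubalgebra F L :=
      { N.toSubmodule ⊓ M.comap (uemb p F L) with
        lie_mem' := fun {x y} hx hy => ⟨N.lie_mem hx.1 hy.1,
          Submodule.mem_sup_left ⟨_, hlieB hx.1 y, rfl⟩⟩ }
    have hpow {x : L} (hx : x ∈ N) : pmap p F L x ∈ K := by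
      refine ⟨hN x hx, Submodule.mem_sup_right ?_⟩
      rw [uemb_pmap, ← mul_pow_sub_one (Fact.out : p.Prime).ne_zero]
      refine Submodule.mul_mem_mul ⟨x, hx, rfl⟩ ?_
      change aug p F L _ = 0
      rw [map_pow, aug_uemb, zero_pow]
      have := (Fact.out : p.Prime).two_le
      omega
    have hle : subPPow p F N ≤ K := by
      refine sInf_le ⟨?_, fun x hx => hpow hx.1⟩
      rintro _ ⟨x, hx, rfl⟩
      exact hpow hx
    exact fun x hx => (hle hx).2
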